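/- The 6×6 matrix μ(κ₁,κ₂,κ₃,κ₄) = [[κ₁I₁,₁ + κ₂LI₁,₁, L, κ₄I₁,₁],[0, κ₃LI₁,₁, I₂],[I₁,₁, 0, κ₁I₁,₁ - κ₂LI₁,₁]] lies in 𝔤 = {X : ᵗXh + hX = 0} for all κ₁, κ₂, κ₃, κ₄ ∈ ℝ, and the map ℝ⁴ → 𝔤 sending (κ₁,κ₂,κ₃,κ₄) to μ(κ₁,κ₂,κ₃,κ₄) is injective and affine. -/

import Mathlib

open Matrix

/-- The 2×2 matrix L = [[0,1],[1,0]]. -/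
def Lm : Matrix (Fin 2) (Fin 2) ℝ := !![0, 1; 1, 0]

/-- The 2×2 matrix I₁,₁ = diag(1,-1). -/
def I11 : Matrix (Fin 2) (Fin 2) ℝ := !![1, 0; 0, -1]

/-- Assemble a 6×6 matrix from a 3×3 array of 2×2 blocks. -/
def blk (M : Matrix (Fin 3) (Fin 3) (Matrix (Fin 2) (Fin 2) ℝ)) :
    Matrix (Fin 6) (Fin 6) ℝ :=
  Matrix.of fun i j =>
    M ⟨i.val / 2, by have := i.isLt; omega⟩ ⟨j.val / 2, by have := j.isLt; omega⟩
      ⟨i.val % 2, by have := i.isLt; omega⟩ ⟨j.val % 2, by have := j.isLt; omega⟩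

/-- The matrix h of the Lie sphere bilinear form, in 2×2 blocks. -/
def hm : Matrix (Fin 6) (Fin 6) ℝ := blk !![0, 0, -Lm; 0, 1, 0; -Lm, 0, 0]

/-- The affine map μ from curvatures (κ₁,κ₂,κ₃,κ₄) to 𝔤. -/
def muMat (k : Fin 4 → ℝ) : Matrix (Fin 6) (Fin 6) ℝ :=
  blk !![k 0 • I11 + k 1 • (Lm * I11), Lm, k 3 • I11;
         0, k 2 • (Lm * I11), 1;
         I11, 0, k 0 • I11 - k 1 • (Lm * I11)]

/-- The entries of a matrix assembled from nine blocks. -/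
lemma blk_eq (a b c d e f p q r : Matrix (Fin 2) (Fin 2) ℝ) :
    blk !![a, b, c; d, e, f; p, q, r] =
      !![a 0 0, a 0 1, b 0 0, b 0 1, c 0 0, c 0 1;
         a 1 0, a 1 1, b 1 0, b 1 1, c 1 0, c 1 1;
         d 0 0, d 0 1, e 0 0, e 0 1, f 0 0, f 0 1;
         d 1 0, d 1 1, e 1 0, e 1 1, f 1 0, f 1 1;
         p 0 0, p 0 1, q 0 0, q 0 1, r 0 0, r 0 1;
         p 1 0, p 1 1, q 1 0, q 1 1, r 1 0, r 1 1] := by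
  ext i j
  fin_cases i <;> fin_cases j <;> rfl

/-- The entries of `hm`. -/
lemma hm_eq : hm = !![0, 0, 0, 0, 0, -1;
                      0, 0, 0, 0, -1, 0;
                      0, 0, 1, 0, 0, 0;
                      0, 0, 0, 1, 0, 0;
                      0, -1, 0, 0, 0, 0;
                      -1, 0, 0, 0, 0, 0] := by
  rw [hm, blk_eq]
  simp [Lm]

/-- The entries of `muMat k`. -/
lemma muMat_eq (k : Fin 4 → ℝ) :
    muMat k = !![k 0, -k 1, 0, 1, k 3, 0;
                 k 1, -k 0, 1, 0, 0, -k 3;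
                 0, 0, 0, -k 2, 1, 0;
                 0, 0, k 2, 0, 0, 1;
                 1, 0, 0, 0, k 0, k 1;
                 0, -1, 0, 0, -k 1, -k 0] := by
  rw [muMat, blk_eq]
  simp [Lm, I11]

/-- μ(κ₁,κ₂,κ₃,κ₄) lies in 𝔤 for all curvatures, and the map μ : ℝ⁴ → 𝔤
is injective and affine. -/
theorem stmt15 :
    (∀ k : Fin 4 → ℝ, (muMat k)ᵀ * hm + hm * muMat k = 0) ∧
    Function.Injective muMat ∧
    (∀ (k k' : Fin 4 → ℝ) (c : ℝ),
      muMat (c • k + (1 - c) • k') = c • muMat k + (1 - c) • muMat k') := by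
  refine ⟨fun k => ?_, fun k k' h => ?_, fun k k' c => ?_⟩
  · rw [muMat_eq, hm_eq]
    ext i j
    fin_cases i <;> fin_cases j <;>
      simp [Matrix.mul_apply, Fin.sum_univ_six]
  · rw [muMat_eq, muMat_eq] at h
    have h0 := congrFun (congrFun h 0) 0
    have h1 := congrFun (congrFun h 1) 0
    have h2 := congrFun (congrFun h 3) 2
    have h3 := congrFun (congrFun h 0) 4
    ext i
    fin_cases i
    exacts [h0, h1, h2, h3]
  · simp only [muMat_eq]
    ext i j
    fin_cases i <;> fin_cases j <;> simp <;> ring
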